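/- First derivative of the exponent function E_h at s = 0: Let W be a classical-quantum channel with finite input alphabet X and outputs density operators on ℂ^d, let σ be a positive definite density operator on ℂ^d, and let P be a probability distribution on X. Then the function s ↦ E_h(s,P,σ) := −(1+s)·Σ_{x:P(x)>0} P(x)·log Tr[W_x^{1/(1+s)} σ^{s/(1+s)}] has right derivative at s = 0 equal to Σ_{x:P(x)>0} P(x)·D(W_x‖σ). -/

import Mathlib

open scoped BigOperators ComplexOrder
open Filter

noncomputable section

namespace MDQ

/-- Functional calculus for Hermitian matrices (junk value `0` otherwise). -/
noncomputable def matFun {d : ℕ} (f : ℝ → ℝ) (A : Matrix (Fin d) (Fin d) ℂ) :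
    Matrix (Fin d) (Fin d) ℂ :=
  if hA : A.IsHermitian then hA.cfc f else 0

/-- Matrix logarithm on the support (`Real.log 0 = 0`). -/
noncomputable def mlog {d : ℕ} (A : Matrix (Fin d) (Fin d) ℂ) : Matrix (Fin d) (Fin d) ℂ :=
  matFun Real.log A

/-- Matrix real power, restricted to the support. -/
noncomputable def mpow {d : ℕ} (A : Matrix (Fin d) (Fin d) ℂ) (p : ℝ) :
    Matrix (Fin d) (Fin d) ℂ :=
  matFun (fun t => if t = 0 then 0 else t ^ p) A

/-- Matrix exponential via functional calculus. -/
noncomputable def mexp {d : ℕ} (A : Matrix (Fin d) (Fin d) ℂ) : Matrix (Fin d) (Fin d) ℂ :=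
  matFun Real.exp A

/-- Orthogonal projection onto the support of a Hermitian matrix. -/
noncomputable def suppProj {d : ℕ} (A : Matrix (Fin d) (Fin d) ℂ) : Matrix (Fin d) (Fin d) ℂ :=
  matFun (fun t => if t = 0 then 0 else 1) A

/-- `A` is a density operator. -/
def IsDensity {d : ℕ} (A : Matrix (Fin d) (Fin d) ℂ) : Prop :=
  A.PosSemidef ∧ A.trace = 1

/-- Real part of the trace. -/
noncomputable def reTr {ι : Type} [Fintype ι] (A : Matrix ι ι ℂ) : ℝ :=
  A.trace.re

/-- supp ρ ⊆ supp σ, phrased via ranges of the associated linear maps. -/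
def SuppLE {d : ℕ} (ρ σ : Matrix (Fin d) (Fin d) ℂ) : Prop :=
  LinearMap.range (Matrix.toLin' ρ) ≤ LinearMap.range (Matrix.toLin' σ)

/-- Quantum relative entropy `D(ρ‖σ)`. -/
noncomputable def qD {d : ℕ} (ρ σ : Matrix (Fin d) (Fin d) ℂ) : ℝ :=
  reTr (ρ * (mlog ρ - mlog σ))

/-- Quantum relative entropy variance `V(ρ‖σ)`. -/
noncomputable def qV {d : ℕ} (ρ σ : Matrix (Fin d) (Fin d) ℂ) : ℝ :=
  reTr (ρ * (mlog ρ - mlog σ) ^ 2) - (qD ρ σ) ^ 2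

/-- The variant relative entropy variance `Ṽ(ρ‖σ)`. -/
noncomputable def qVtilde {d : ℕ} (ρ σ : Matrix (Fin d) (Fin d) ℂ) : ℝ :=
  (∫ t in (0:ℝ)..1,
    reTr (mpow ρ (1 - t) * (mlog ρ - mlog σ) * mpow ρ t * (mlog ρ - mlog σ))) - (qD ρ σ) ^ 2

/-- The quantum Rényi divergence of order zero, `D₀(ρ‖σ) = -log Tr[Π_ρ σ]`. -/
noncomputable def qD0 {d : ℕ} (ρ σ : Matrix (Fin d) (Fin d) ℂ) : ℝ :=
  - Real.log (reTr (suppProj ρ * σ))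

/-- Tensor product of a finite family of `d × d` matrices. -/
noncomputable def tensorSeq {d n : ℕ} (A : Fin n → Matrix (Fin d) (Fin d) ℂ) :
    Matrix (Fin n → Fin d) (Fin n → Fin d) ℂ :=
  Matrix.of fun i j => ∏ k, A k (i k) (j k)

/-- `n`-fold tensor power of a matrix. -/
noncomputable def tensorPow {d : ℕ} (A : Matrix (Fin d) (Fin d) ℂ) (n : ℕ) :
    Matrix (Fin n → Fin d) (Fin n → Fin d) ℂ :=
  tensorSeq (fun _ => A)

/-- Smallest type-I error with type-II error at most `μ`:  `α̂_μ(ρ‖σ)`. -/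
noncomputable def hypoErr {ι : Type} [Fintype ι] [DecidableEq ι]
    (ρ σ : Matrix ι ι ℂ) (μ : ℝ) : ℝ :=
  sInf { a : ℝ | ∃ Q : Matrix ι ι ℂ, Q.PosSemidef ∧ (1 - Q).PosSemidef ∧
    reTr (Q * σ) ≤ μ ∧ a = reTr ((1 - Q) * ρ) }

/-- `P` is a probability distribution on a finite alphabet. -/
def IsProbDist {X : Type} [Fintype X] (P : X → ℝ) : Prop :=
  (∀ x, 0 ≤ P x) ∧ ∑ x, P x = 1

/-- The average output state `PW`. -/
noncomputable def avgState {X : Type} [Fintype X] {d : ℕ}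
    (P : X → ℝ) (W : X → Matrix (Fin d) (Fin d) ℂ) : Matrix (Fin d) (Fin d) ℂ :=
  ∑ x, (P x : ℂ) • W x

/-- Mutual information `I(P, W)`. -/
noncomputable def mutualInfo {X : Type} [Fintype X] {d : ℕ}
    (P : X → ℝ) (W : X → Matrix (Fin d) (Fin d) ℂ) : ℝ :=
  ∑ x, P x * qD (W x) (avgState P W)

/-- Capacity `C_W`. -/
noncomputable def capacity {X : Type} [Fintype X] {d : ℕ}
    (W : X → Matrix (Fin d) (Fin d) ℂ) : ℝ :=
  sSup { c : ℝ | ∃ P : X → ℝ, IsProbDist P ∧ c = mutualInfo P W }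

/-- Conditional information variance `V(P, W)`. -/
noncomputable def infoVar {X : Type} [Fintype X] {d : ℕ}
    (P : X → ℝ) (W : X → Matrix (Fin d) (Fin d) ℂ) : ℝ :=
  ∑ x, P x * qV (W x) (avgState P W)

/-- The variant conditional information variance `Ṽ(P, W)`. -/
noncomputable def infoVarTilde {X : Type} [Fintype X] {d : ℕ}
    (P : X → ℝ) (W : X → Matrix (Fin d) (Fin d) ℂ) : ℝ :=
  ∑ x, P x * qVtilde (W x) (avgState P W)

/-- Minimal peripheral information variance `V_W`. -/
noncomputable def Vmin {X : Type} [Fintype X] {d : ℕ}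
    (W : X → Matrix (Fin d) (Fin d) ℂ) : ℝ :=
  sInf { v : ℝ | ∃ P : X → ℝ, IsProbDist P ∧ mutualInfo P W = capacity W ∧ v = infoVar P W }

/-- Minimal variant peripheral information variance `Ṽ_W`. -/
noncomputable def VminTilde {X : Type} [Fintype X] {d : ℕ}
    (W : X → Matrix (Fin d) (Fin d) ℂ) : ℝ :=
  sInf { v : ℝ | ∃ P : X → ℝ, IsProbDist P ∧ mutualInfo P W = capacity W ∧ v = infoVarTilde P W }

/-- Conditional relative entropy `D(W‖σ|P)`. -/
noncomputable def Dcond {X : Type} [Fintype X] {d : ℕ}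
    (W : X → Matrix (Fin d) (Fin d) ℂ) (σ : Matrix (Fin d) (Fin d) ℂ) (P : X → ℝ) : ℝ :=
  ∑ x, P x * qD (W x) σ

/-- Conditional relative entropy variance `V(W‖σ|P)`. -/
noncomputable def Vcond {X : Type} [Fintype X] {d : ℕ}
    (W : X → Matrix (Fin d) (Fin d) ℂ) (σ : Matrix (Fin d) (Fin d) ℂ) (P : X → ℝ) : ℝ :=
  ∑ x, P x * qV (W x) σ

/-- Conditional order-zero Rényi divergence `D₀(W‖σ|P)`. -/
noncomputable def D0cond {X : Type} [Fintype X] {d : ℕ}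
    (W : X → Matrix (Fin d) (Fin d) ℂ) (σ : Matrix (Fin d) (Fin d) ℂ) (P : X → ℝ) : ℝ :=
  ∑ x, P x * qD0 (W x) σ

/-- The exponent function `E_h(s, P, σ)`. -/
noncomputable def Eh {X : Type} [Fintype X] {d : ℕ}
    (W : X → Matrix (Fin d) (Fin d) ℂ) (s : ℝ) (P : X → ℝ)
    (σ : Matrix (Fin d) (Fin d) ℂ) : ℝ :=
  -(1 + s) * ∑ x, P x * Real.log (reTr (mpow (W x) (1 / (1 + s)) * mpow σ (s / (1 + s))))

/-- The log-Euclidean exponent function `Ẽ_h(s, P, σ)`. -/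
noncomputable def EhTilde {X : Type} [Fintype X] {d : ℕ}
    (W : X → Matrix (Fin d) (Fin d) ℂ) (s : ℝ) (P : X → ℝ)
    (σ : Matrix (Fin d) (Fin d) ℂ) : ℝ :=
  -(1 + s) * ∑ x, P x *
    Real.log (reTr (mexp ((((1 + s)⁻¹ : ℝ) : ℂ) • (mlog (W x) + ((s : ℝ) : ℂ) • mlog σ))))

/-- The modified auxiliary function `Ẽ₀(s, P, σ)`. -/
noncomputable def E0Tilde {X : Type} [Fintype X] {d : ℕ}
    (W : X → Matrix (Fin d) (Fin d) ℂ) (s : ℝ) (P : X → ℝ)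
    (σ : Matrix (Fin d) (Fin d) ℂ) : ℝ :=
  - Real.log (∑ x, P x * reTr (mpow (W x) (1 - s) * mpow σ s))

/-- The sphere-packing exponent `E_sp^{(2)}(R, P, σ)`. -/
noncomputable def Esp2 {X : Type} [Fintype X] {d : ℕ}
    (W : X → Matrix (Fin d) (Fin d) ℂ) (R : ℝ) (P : X → ℝ)
    (σ : Matrix (Fin d) (Fin d) ℂ) : ℝ :=
  sSup { e : ℝ | ∃ s : ℝ, 0 ≤ s ∧ e = Eh W s P σ - s * R }

/-- The sphere-packing exponent `Ẽ_sp(R, P, σ)`. -/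
noncomputable def EspTilde {X : Type} [Fintype X] {d : ℕ}
    (W : X → Matrix (Fin d) (Fin d) ℂ) (R : ℝ) (P : X → ℝ)
    (σ : Matrix (Fin d) (Fin d) ℂ) : ℝ :=
  sSup { e : ℝ | ∃ s : ℝ, 0 ≤ s ∧ e = EhTilde W s P σ - s * R }

open Classical in
/-- Empirical distribution of a word `x^n ∈ X^n`. -/
noncomputable def empDist {X : Type} [Fintype X] {n : ℕ} (xs : Fin n → X) (x : X) : ℝ :=
  ((Finset.univ.filter fun i => xs i = x).card : ℝ) / n

/-- Smallest average error probability `ε*(n, R)` over all `n`-blocklength codes with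
`⌈exp (n R)⌉` messages. -/
noncomputable def optErr {X : Type} [Fintype X] {d : ℕ}
    (W : X → Matrix (Fin d) (Fin d) ℂ) (n : ℕ) (R : ℝ) : ℝ :=
  sInf { e : ℝ | ∃ (f : Fin ⌈Real.exp (n * R)⌉₊ → Fin n → X)
    (Pov : Fin ⌈Real.exp (n * R)⌉₊ → Matrix (Fin n → Fin d) (Fin n → Fin d) ℂ),
    (∀ m, (Pov m).PosSemidef) ∧ (∑ m, Pov m) = 1 ∧
    e = (1 / (⌈Real.exp (n * R)⌉₊ : ℝ)) *
      ∑ m, (1 - reTr (Pov m * tensorSeq (fun k => W (f m k)))) }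

/-- The binary entropy function. -/
noncomputable def binEnt (p : ℝ) : ℝ :=
  -p * Real.log p - (1 - p) * Real.log (1 - p)

theorem matFun_apply {d : ℕ} {A : Matrix (Fin d) (Fin d) ℂ} (hA : A.IsHermitian)
    (f : ℝ → ℝ) (i j : Fin d) :
    matFun f A i j = ∑ k, (hA.eigenvectorUnitary : Matrix (Fin d) (Fin d) ℂ) i k *
      (f (hA.eigenvalues k) : ℂ) *
        star ((hA.eigenvectorUnitary : Matrix (Fin d) (Fin d) ℂ) j k) := by
  rw [matFun, dif_pos hA, Matrix.IsHermitian.cfc, Unitary.conjStarAlgAut_apply, Matrix.mul_apply]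
  simp [Matrix.mul_diagonal, Matrix.star_apply]

theorem matFun_congr {d : ℕ} {A : Matrix (Fin d) (Fin d) ℂ} (hA : A.IsHermitian)
    {f g : ℝ → ℝ} (hfg : ∀ k, f (hA.eigenvalues k) = g (hA.eigenvalues k)) :
    matFun f A = matFun g A := by
  ext i j
  simp [matFun_apply hA, hfg]

theorem matFun_mul {d : ℕ} {A : Matrix (Fin d) (Fin d) ℂ} (hA : A.IsHermitian) (f g : ℝ → ℝ) :
    matFun f A * matFun g A = matFun (fun t => f t * g t) A := by
  simp only [matFun, dif_pos hA, Matrix.IsHermitian.cfc, ← map_mul, Matrix.diagonal_mul_diagonal]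
  congr 2
  ext k
  simp

theorem matFun_id {d : ℕ} {A : Matrix (Fin d) (Fin d) ℂ} (hA : A.IsHermitian) :
    matFun (fun t => t) A = A := by
  rw [matFun, dif_pos hA]
  exact hA.spectral_theorem.symm

theorem matFun_one {d : ℕ} {A : Matrix (Fin d) (Fin d) ℂ} (hA : A.IsHermitian) :
    matFun (fun _ => 1) A = 1 := by
  rw [matFun, dif_pos hA, Matrix.IsHermitian.cfc, ← map_one (Unitary.conjStarAlgAut ℂ _
    hA.eigenvectorUnitary)]
  congr 1

theorem mpow_one {d : ℕ} {A : Matrix (Fin d) (Fin d) ℂ} (hA : A.IsHermitian) :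
    mpow A 1 = A := by
  conv_rhs => rw [← matFun_id hA]
  exact matFun_congr hA fun k => by by_cases h : hA.eigenvalues k = 0 <;> simp [h]

theorem mpow_zero_of_posDef {d : ℕ} {A : Matrix (Fin d) (Fin d) ℂ} (hA : A.PosDef) :
    mpow A 0 = 1 := by
  rw [← matFun_one hA.isHermitian]
  exact matFun_congr hA.isHermitian fun k => by simp [(hA.eigenvalues_pos k).ne']

theorem hasDerivAt_mpow_apply {d : ℕ} {A : Matrix (Fin d) (Fin d) ℂ} (hA : A.PosSemidef)
    {p : ℝ → ℝ} {p' s : ℝ} (hp : HasDerivAt p p' s) (i j : Fin d) :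
    HasDerivAt (fun u => mpow A (p u) i j) (p' * (mpow A (p s) * mlog A) i j) s := by
  have hH := hA.isHermitian
  have hlam (k : Fin d) : HasDerivAt
      (fun u => if hH.eigenvalues k = 0 then 0 else hH.eigenvalues k ^ p u)
      (p' * ((if hH.eigenvalues k = 0 then 0 else hH.eigenvalues k ^ p s) *
        Real.log (hH.eigenvalues k))) s := by
    by_cases h : hH.eigenvalues k = 0
    · simpa [h] using hasDerivAt_const s (0 : ℝ)
    · simp only [h, if_false]
      convert hp.const_rpow (lt_of_le_of_ne (hA.eigenvalues_nonneg k) (Ne.symm h)) using 1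
      ring
  have hsum := HasDerivAt.fun_sum fun k (_ : k ∈ Finset.univ) =>
    (((hlam k).ofReal_comp.const_mul
      ((hH.eigenvectorUnitary : Matrix (Fin d) (Fin d) ℂ) i k)).mul_const
        (star ((hH.eigenvectorUnitary : Matrix (Fin d) (Fin d) ℂ) j k)))
  simp only [mpow, mlog, matFun_mul hH, matFun_apply hH]
  refine hsum.congr_deriv ?_
  rw [Finset.mul_sum]
  refine Finset.sum_congr rfl fun k _ => ?_
  push_cast
  ring

theorem hasDerivAt_reTr_mul {d : ℕ} {A B : ℝ → Matrix (Fin d) (Fin d) ℂ}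
    {A' B' : Matrix (Fin d) (Fin d) ℂ} {s : ℝ}
    (hA : ∀ i j, HasDerivAt (fun u => A u i j) (A' i j) s)
    (hB : ∀ i j, HasDerivAt (fun u => B u i j) (B' i j) s) :
    HasDerivAt (fun u => reTr (A u * B u)) (reTr (A' * B s + A s * B')) s := by
  have h := HasDerivAt.fun_sum fun i (_ : i ∈ Finset.univ) =>
    HasDerivAt.fun_sum fun j (_ : j ∈ Finset.univ) => (hA i j).mul (hB j i)
  have h' := Complex.reCLM.hasFDerivAt.comp_hasDerivAt s h
  simpa [reTr, Matrix.trace, Matrix.mul_apply, Function.comp_def, Finset.sum_add_distrib] using h'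

theorem hasDerivAt_reTr_mpow_mul_mpow {d : ℕ} {ρ σ : Matrix (Fin d) (Fin d) ℂ}
    (hρ : ρ.PosSemidef) (hσ : σ.PosDef) :
    HasDerivAt (fun s : ℝ => reTr (mpow ρ (1 / (1 + s)) * mpow σ (s / (1 + s))))
      (-qD ρ σ) 0 := by
  have hadd : HasDerivAt (fun s : ℝ => 1 + s) 1 0 := (hasDerivAt_id 0).const_add 1
  have hp : HasDerivAt (fun s : ℝ => 1 / (1 + s)) (-1) 0 := by
    simpa using (hasDerivAt_const (0 : ℝ) (1 : ℝ)).fun_div hadd (by norm_num)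
  have hq : HasDerivAt (fun s : ℝ => s / (1 + s)) 1 0 := by
    simpa using (hasDerivAt_id (0 : ℝ)).fun_div hadd (by norm_num)
  have h := hasDerivAt_reTr_mul
    (A' := -(ρ * mlog ρ)) (B' := mlog σ)
    (fun i j => by simpa [mpow_one hρ.isHermitian] using hasDerivAt_mpow_apply hρ hp i j)
    (fun i j => by
      simpa [mpow_zero_of_posDef hσ] using hasDerivAt_mpow_apply hσ.posSemidef hq i j)
  simp only [one_div] at h ⊢
  refine h.congr_deriv ?_
  simp [mpow_one hρ.isHermitian, mpow_zero_of_posDef hσ, qD, reTr, mul_sub]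
  ring

/-- **First (right) derivative of the exponent function `E_h` at `s = 0`.** -/
theorem Eh_hasDerivWithinAt_zero
    {X : Type} [Fintype X] {d : ℕ}
    (W : X → Matrix (Fin d) (Fin d) ℂ) (hW : ∀ x, IsDensity (W x))
    (σ : Matrix (Fin d) (Fin d) ℂ) (hσ : σ.PosDef ∧ σ.trace = 1)
    (P : X → ℝ) (hP : IsProbDist P) :
    HasDerivWithinAt (fun s => Eh W s P σ) (∑ x, P x * qD (W x) σ) (Set.Ici 0) 0 := by
  have hval (x : X) :
      reTr (mpow (W x) (1 / (1 + 0)) * mpow σ (0 / (1 + 0))) = 1 := by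
    simp [mpow_one (hW x).1.isHermitian, mpow_zero_of_posDef hσ.1, reTr, (hW x).2]
  have hsum := HasDerivAt.fun_sum fun x (_ : x ∈ Finset.univ) =>
    ((hasDerivAt_reTr_mpow_mul_mpow (hW x).1 hσ.1).log (by rw [hval]; exact one_ne_zero)).const_mul (P x)
  have h := ((hasDerivAt_id (0 : ℝ)).const_add 1).fun_neg.fun_mul hsum
  refine HasDerivAt.hasDerivWithinAt ?_
  refine h.congr_deriv ?_
  simp only [hval]
  simp

end MDQ
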